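/- arXiv:2204.02927 — 4 statements merged into one kernel-verified Lean document; each statement's English description precedes it below -/
import Mathlib

section
/- Let F : C ⟶ D, F̄ : C̄ ⟶ D̄, g : C ⟶ C̄ and G : D ⟶ D̄ be functors together with a natural isomorphism μ : G ∘ F ≅ F̄ ∘ g. Assume that F̄ has a right adjoint X̄, that g and G are fully faithful and have left adjoints h and H respectively, and that the exchange (mate) transformation H ∘ F̄ ⇒ F ∘ h associated with μ is an isomorphism. Then the composite functor h ∘ X̄ ∘ G is right adjoint to F. -/
open CategoryTheory

/-- If `h ⋙ F ⊣ R`, where `h` is a reflector onto a full subcategory, then the objects `R.obj N`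
are local: the unit of the reflection is invertible at each of them. -/
theorem isIso_unit_app_of_adjunction_comp {C D C' : Type*} [Category C] [Category D] [Category C']
    {F : C ⥤ D} {g : C ⥤ C'} {h : C' ⥤ C} {R : D ⥤ C'} [g.Full] [g.Faithful]
    (adjh : h ⊣ g) (adj : h ⋙ F ⊣ R) (N : D) :
    IsIso (adjh.unit.app (R.obj N)) := by
  let _ : Reflective g := { L := h, adj := adjh }
  let η : R.obj N ⟶ g.obj (h.obj (R.obj N)) := adjh.unit.app (R.obj N)
  have : IsIso (h.map η) := by
    have : IsIso (h.map η ≫ adjh.counit.app (h.obj (R.obj N))) := by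
      rw [adjh.left_triangle_components]
      infer_instance
    exact IsIso.of_isIso_comp_right _ (adjh.counit.app (h.obj (R.obj N)))
  have : IsIso ((h ⋙ F).map η) := inferInstanceAs (IsIso (F.map (h.map η)))
  let r : g.obj (h.obj (R.obj N)) ⟶ R.obj N :=
    adj.homEquiv _ N (inv ((h ⋙ F).map η) ≫ adj.counit.app N)
  have hr : η ≫ r = 𝟙 (R.obj N) := by
    rw [← adj.homEquiv_naturality_left, IsIso.hom_inv_id_assoc]
    simp [Adjunction.homEquiv_unit]
  have : IsSplitMono ((reflectorAdjunction g).unit.app (R.obj N)) := ⟨⟨⟨r, hr⟩⟩⟩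
  exact (mem_essImage_of_unit_isSplitMono (i := g) (A := R.obj N)).unit_isIso

/-- Let `F : C ⟶ D`, `F̄ : C̄ ⟶ D̄`, `g : C ⟶ C̄`, `G : D ⟶ D̄` be functors,
`μ : G ∘ F ≅ F̄ ∘ g` a natural isomorphism, `X̄` a right adjoint of `F̄`, `h ⊣ g` and `H ⊣ G`
adjunctions with `g`, `G` fully faithful.  If the mate `H ∘ F̄ ⇒ F ∘ h` of `μ` is an
isomorphism, then `h ∘ X̄ ∘ G` is right adjoint to `F`. -/
theorem statement0 {C D C' D' : Type*} [Category C] [Category D] [Category C'] [Category D']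
    (F : C ⥤ D) (Fbar : C' ⥤ D') (g : C ⥤ C') (G : D ⥤ D')
    (μ : F ⋙ G ≅ g ⋙ Fbar)
    (Xbar : D' ⥤ C') (adjX : Fbar ⊣ Xbar)
    (h : C' ⥤ C) (adjh : h ⊣ g)
    (H : D' ⥤ D) (adjH : H ⊣ G)
    [g.Full] [g.Faithful] [G.Full] [G.Faithful]
    (hmate : IsIso ((mateEquiv adjh adjH).symm μ.inv)) :
    Nonempty (F ⊣ G ⋙ Xbar ⋙ h) := by
  let e : Fbar ⋙ H ≅ h ⋙ F := @asIso _ _ _ _ ((mateEquiv adjh adjH).symm μ.inv) hmate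
  let adj : h ⋙ F ⊣ G ⋙ Xbar := (adjX.comp adjH).ofNatIsoLeft e
  have (N : D) : IsIso ((Functor.whiskerLeft (G ⋙ Xbar) adjh.unit).app N) :=
    isIso_unit_app_of_adjunction_comp adjh adj N
  have : IsIso (Functor.whiskerLeft (G ⋙ Xbar) adjh.unit) := NatIso.isIso_of_isIso_app _
  exact ⟨adjX.restrictFullyFaithful (Functor.FullyFaithful.ofFullyFaithful g)
    (Functor.FullyFaithful.ofFullyFaithful G) μ.symm
    (asIso (Functor.whiskerLeft (G ⋙ Xbar) adjh.unit))⟩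
end

section
/- Let S be a small category with finite limits equipped with a subcanonical Grothendieck pretopology, and let κ be a family of cardinals closed under decomposition (passing to cardinalities of subfamilies). Assume S is κ-superextensive, i.e.: (1) every covering family contains a covering subfamily of cardinality belonging to κ; (2) S is κ-extensive — coproducts of families of cardinality in κ exist, are disjoint and are universal (stable under pullback) — and every family of coproduct inclusions (X_j → ⨿_j X_j) of cardinality in κ is a covering family. Then S is geometric: for every small family (X_j) of objects of S with F := L(⨿_j h(X_j)), every Y ∈ S, and every morphism of sheaves Lh(Y) → F × F, the fiber product Lh(Y) ×_{F×F} F along the diagonal of F is representable. -/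
open CategoryTheory CategoryTheory.Limits

universe u

section Gluing

variable {C : Type u} [SmallCategory C] {J : GrothendieckTopology C}

open Opposite

theorem CategoryTheory.Functor.map_op_comp_apply (F : Cᵒᵖ ⥤ Type u) {U V W : C} (g : U ⟶ V)
    (f : V ⟶ W) (a : F.obj (op W)) : F.map (g ≫ f).op a = F.map g.op (F.map f.op a) := by
  simp

/-- If sections of a separated presheaf `F` of the form `s` restricted along `W ⟶ X` determine
the morphism `W ⟶ X`, then a section of `F` that is locally such a restriction is globally one. -/
theorem exists_map_eq_of_locally {F : Cᵒᵖ ⥤ Type u} (hF : Presieve.IsSeparated J F) {X : C}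
    (hX : Presieve.IsSheaf J (yoneda.obj X)) (s : F.obj (op X))
    (hs : ∀ ⦃W : C⦄ (α β : W ⟶ X), F.map α.op s = F.map β.op s → α = β)
    {V : C} (a : F.obj (op V)) {T : Sieve V} (hT : T ∈ J V)
    (h : ∀ ⦃W : C⦄ (f : W ⟶ V), T f → ∃ α : W ⟶ X, F.map α.op s = F.map f.op a) :
    ∃ α : V ⟶ X, F.map α.op s = a := by
  choose α hα using h
  let x : Presieve.FamilyOfElements (yoneda.obj X) (T : Presieve V) := fun W f hf => α f hf
  have hx : x.Compatible := by
    intro Y₁ Y₂ Z g₁ g₂ f₁ f₂ h₁ h₂ e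
    apply hs
    change F.map (g₁ ≫ α f₁ h₁).op s = F.map (g₂ ≫ α f₂ h₂).op s
    rw [F.map_op_comp_apply, F.map_op_comp_apply, hα, hα, ← F.map_op_comp_apply,
      ← F.map_op_comp_apply, e]
  refine ⟨(hX T hT).amalgamate x hx, (hF T hT).ext fun W f hf => ?_⟩
  have : f ≫ (hX T hT).amalgamate x hx = α f hf := (hX T hT).valid_glue hx f hf
  rw [← hα f hf, ← this, F.map_op_comp_apply]

theorem hom_eq_of_locally {X : C} (hX : Presieve.IsSheaf J (yoneda.obj X)) {V : C} {α β : V ⟶ X}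
    {T : Sieve V} (hT : T ∈ J V) (h : ∀ ⦃W : C⦄ (f : W ⟶ V), T f → f ≫ α = f ≫ β) : α = β :=
  (hX.isSeparated T hT).ext fun _ f hf => h f hf

/-- A topology for which coverings have refinements indexed by types of cardinality in `κ`, and
for which coproducts of such families exist, are disjoint (up to objects covered by the empty
family) and are covered by their inclusions. -/
structure IsSuperextensive (J : GrothendieckTopology C)
    (κ : Set Cardinal.{u}) : Prop where
  mem_of_le : ∀ c ∈ κ, ∀ c' ≤ c, c' ∈ κ
  exists_refinement : ∀ ⦃V : C⦄ (T : Sieve V), T ∈ J V →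
    ∃ (I : Type u) (U : I → C) (f : ∀ i, U i ⟶ V), Cardinal.mk I ∈ κ ∧
      Sieve.ofArrows U f ∈ J V ∧ ∀ i, T (f i)
  exists_cofan : ∀ (I : Type u) (X : I → C), Cardinal.mk I ∈ κ →
    ∃ c : Cofan X, Nonempty (IsColimit c) ∧ (∀ i, Mono (c.inj i)) ∧
      (∀ ⦃i i' : I⦄, i ≠ i' → ∀ ⦃W : C⦄ (g : W ⟶ X i) (g' : W ⟶ X i'),
        g ≫ c.inj i = g' ≫ c.inj i' → ⊥ ∈ J W) ∧
      Sieve.ofArrows X c.inj ∈ J c.pt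

namespace IsSuperextensive

variable {κ : Set Cardinal.{u}} (hJ : IsSuperextensive J κ)
  (hsub : ∀ X : C, Presieve.IsSheaf J (yoneda.obj X))

include hJ hsub

/-- Grouping the members of a covering family according to labels that agree on nonempty
overlaps decomposes the base into disjoint pieces. -/
theorem exists_decomposition [HasFiniteLimits C] {Y : C} {I : Type u} {U : I → C}
    {f : ∀ i, U i ⟶ Y} (hI : Cardinal.mk I ∈ κ) (hf : Sieve.ofArrows U f ∈ J Y) {P : Type u}
    (p : I → P)
    (hp : ∀ i i', p i ≠ p i' → ∀ ⦃W : C⦄ (g : W ⟶ U i) (g' : W ⟶ U i'),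
      g ≫ f i = g' ≫ f i' → ⊥ ∈ J W) :
    ∃ (D : Set.range p → C) (d : ∀ r, D r ⟶ Y), (∀ r, Mono (d r)) ∧
      Sieve.ofArrows D d ∈ J Y ∧
      (∀ ⦃r r'⦄, r ≠ r' → ∀ ⦃W : C⦄ (g : W ⟶ D r) (g' : W ⟶ D r'),
        g ≫ d r = g' ≫ d r' → ⊥ ∈ J W) ∧
      (∀ (r : Set.range p) i, p i ≠ r → ∀ ⦃W : C⦄ (g : W ⟶ D r) (g' : W ⟶ U i),
        g ≫ d r = g' ≫ f i → ⊥ ∈ J W) := by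
  obtain ⟨c, -, hmono, hdisj, hcov⟩ := hJ.exists_cofan (Set.range p) (fun _ => ⊤_ C)
    (hJ.mem_of_le _ hI _ Cardinal.mk_range_le)
  let t (i : I) : U i ⟶ c.pt := terminal.from _ ≫ c.inj ⟨p i, i, rfl⟩
  obtain ⟨q, hq, -⟩ := (Presieve.isSheafFor_arrows_iff _ _).1
    ((Presieve.isSheafFor_iff_generate _).2 (hsub c.pt _ hf)) t (by
      intro i i' W g g' h
      change g ≫ t i = g' ≫ t i'
      by_cases hii : p i = p i'
      · have : (⟨p i, i, rfl⟩ : Set.range p) = ⟨p i', i', rfl⟩ := Subtype.ext hii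
        simp only [t, this, ← Category.assoc]
        congr 1
        exact Subsingleton.elim _ _
      · exact hom_eq_of_locally (hsub _) (hp i i' hii g g' h) (fun _ _ h => h.elim))
  replace hq (i) : f i ≫ q = t i := hq i
  refine ⟨fun r => pullback q (c.inj r), fun r => pullback.fst _ _, fun r => inferInstance,
    J.superset_covering ?_ (J.pullback_stable q hcov), ?_, ?_⟩
  · intro W w hw
    obtain ⟨r, h, e⟩ := (Sieve.mem_ofArrows_iff _ _ _).1 hw
    exact (Sieve.mem_ofArrows_iff _ _ _).2 ⟨r, pullback.lift w h e,
      (pullback.lift_fst _ _ _).symm⟩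
  · intro r r' hr W g g' e
    refine hdisj hr (g ≫ pullback.snd _ _) (g' ≫ pullback.snd _ _) ?_
    simp only [Category.assoc, ← pullback.condition, reassoc_of% e]
  · intro r i hi W g g' e
    refine hdisj (i := r) (i' := ⟨p i, i, rfl⟩) (fun h => hi (congrArg Subtype.val h).symm)
      (g ≫ pullback.snd _ _) (g' ≫ terminal.from _) ?_
    rw [Category.assoc, Category.assoc, ← pullback.condition, reassoc_of% e, hq]

/-- A disjoint family of subobjects of cardinality in `κ` has a union, which is covered by
the members of the family. -/
theorem exists_union {Y : C} {I : Type u} (hI : Cardinal.mk I ∈ κ) {E : I → C}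
    (e : ∀ i, E i ⟶ Y) [∀ i, Mono (e i)]
    (he : ∀ ⦃i i'⦄, i ≠ i' → ∀ ⦃W : C⦄ (g : W ⟶ E i) (g' : W ⟶ E i'),
      g ≫ e i = g' ≫ e i' → ⊥ ∈ J W) :
    ∃ (Z : C) (m : Z ⟶ Y) (k : ∀ i, E i ⟶ Z), Mono m ∧ (∀ i, k i ≫ m = e i) ∧
      Sieve.ofArrows E k ∈ J Z := by
  obtain ⟨c, ⟨hc⟩, -, -, hcov⟩ := hJ.exists_cofan I E hI
  have fac (i) : c.inj i ≫ Cofan.IsColimit.desc hc e = e i := Cofan.IsColimit.fac hc e i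
  refine ⟨c.pt, Cofan.IsColimit.desc hc e, c.inj, ⟨fun {V} u v huv => ?_⟩, fac, hcov⟩
  refine hom_eq_of_locally (hsub _) (J.intersection_covering (J.pullback_stable u hcov)
    (J.pullback_stable v hcov)) fun W w hw => ?_
  obtain ⟨i, g, hg⟩ := (Sieve.mem_ofArrows_iff _ _ _).1 hw.1
  obtain ⟨i', g', hg'⟩ := (Sieve.mem_ofArrows_iff _ _ _).1 hw.2
  have key : g ≫ e i = g' ≫ e i' := by
    rw [← fac, ← fac, ← reassoc_of% hg, ← reassoc_of% hg', huv]
  rw [hg, hg']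
  by_cases hii : i = i'
  · subst hii
    rw [(cancel_mono (e i)).1 key]
  · exact hom_eq_of_locally (hsub _) (he hii g g' key) (fun _ _ h => h.elim)

/-- Let `F` be a separated presheaf that is locally a disjoint union of representables, via the
sections `s j`. Then the locus where two sections of `F` agree is representable. -/
theorem exists_mono_iff_map_eq [HasFiniteLimits C] {F : Cᵒᵖ ⥤ Type u}
    (hF : Presieve.IsSeparated J F) {A : Type u} {X : A → C} (s : ∀ j, F.obj (op (X j)))
    (hloc : ∀ ⦃V : C⦄ (a : F.obj (op V)), ∃ T ∈ J V, ∀ ⦃W : C⦄ (f : W ⟶ V), T f →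
      ∃ (j : A) (α : W ⟶ X j), F.map α.op (s j) = F.map f.op a)
    (hinj : ∀ j ⦃W : C⦄ (α β : W ⟶ X j), F.map α.op (s j) = F.map β.op (s j) → α = β)
    (hdisj : ∀ ⦃j k⦄, j ≠ k → ∀ ⦃W : C⦄ (α : W ⟶ X j) (β : W ⟶ X k),
      F.map α.op (s j) = F.map β.op (s k) → ⊥ ∈ J W)
    {Y : C} (a b : F.obj (op Y)) :
    ∃ (Z : C) (m : Z ⟶ Y), Mono m ∧ ∀ ⦃V : C⦄ (f : V ⟶ Y),
      (∃ g, g ≫ m = f) ↔ F.map f.op a = F.map f.op b := by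
  obtain ⟨Ta, hTa, ha⟩ := hloc a
  obtain ⟨Tb, hTb, hb⟩ := hloc b
  obtain ⟨I, U, f, hI, hf, hT⟩ :=
    hJ.exists_refinement (Ta ⊓ Tb) (J.intersection_covering hTa hTb)
  choose j α hα using fun i => ha (f i) (hT i).1
  choose k β hβ using fun i => hb (f i) (hT i).2
  let p (i : I) : A × A := (j i, k i)
  obtain ⟨D, d, hdmono, hdcov, hddisj, hdf⟩ := hJ.exists_decomposition hsub hI hf p (by
      intro i i' hne W g g' h
      by_cases hj : j i = j i'
      · have hk : k i ≠ k i' := fun hk => hne (Prod.ext hj hk)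
        refine hdisj hk (g ≫ β i) (g' ≫ β i') ?_
        rw [F.map_op_comp_apply, F.map_op_comp_apply, hβ, hβ, ← F.map_op_comp_apply,
          ← F.map_op_comp_apply, h]
      · refine hdisj hj (g ≫ α i) (g' ≫ α i') ?_
        rw [F.map_op_comp_apply, F.map_op_comp_apply, hα, hα, ← F.map_op_comp_apply,
          ← F.map_op_comp_apply, h])
  have piece (c : F.obj (op Y)) (l : A × A → A)
      (hc : ∀ i, ∃ γ : U i ⟶ X (l (p i)), F.map γ.op (s _) = F.map (f i).op c) (r : Set.range p) :
      ∃ γ : D r ⟶ X (l r), F.map γ.op (s _) = F.map (d r).op c := by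
    refine exists_map_eq_of_locally hF (hsub _) (s _) (hinj _) _ (J.pullback_stable (d r) hf)
      fun W w hw => ?_
    obtain ⟨i, g, hg⟩ := (Sieve.mem_ofArrows_iff _ _ _).1 hw
    by_cases hi : p i = r
    · obtain ⟨γ, hγ⟩ : ∃ γ : U i ⟶ X (l r), F.map γ.op (s _) = F.map (f i).op c := hi ▸ hc i
      refine ⟨g ≫ γ, ?_⟩
      rw [F.map_op_comp_apply, hγ, ← F.map_op_comp_apply, ← F.map_op_comp_apply, hg]
    · exact exists_map_eq_of_locally hF (hsub _) (s _) (hinj _) _ (hdf r i hi w g hg)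
        fun _ _ h => h.elim
  choose α' hα' using piece a (fun x => x.1) fun i => ⟨α i, hα i⟩
  choose β' hβ' using piece b (fun x => x.2) fun i => ⟨β i, hβ i⟩
  have eqz (r : Set.range p) (hr : r.1.1 = r.1.2) : ∃ (E : C) (e : E ⟶ D r), Mono e ∧
      ∀ ⦃V : C⦄ (g : V ⟶ D r), (∃ h, h ≫ e = g) ↔
        F.map (g ≫ d r).op a = F.map (g ≫ d r).op b := by
    obtain ⟨δ, hδ⟩ : ∃ δ : D r ⟶ X r.1.1, F.map δ.op (s _) = F.map (d r).op b :=
      hr ▸ ⟨β' r, hβ' r⟩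
    refine ⟨equalizer (α' r) δ, equalizer.ι (α' r) δ, inferInstance, fun V g => ?_⟩
    rw [F.map_op_comp_apply, F.map_op_comp_apply, ← hα', ← hδ, ← F.map_op_comp_apply,
      ← F.map_op_comp_apply]
    refine ⟨?_, fun h => ⟨equalizer.lift g (hinj _ _ _ h), by simp⟩⟩
    rintro ⟨h, rfl⟩
    simp only [Category.assoc, equalizer.condition]
  let R' := {r : Set.range p // r.1.1 = r.1.2}
  choose E e hemono he using fun r : R' => eqz r.1 r.2
  obtain ⟨Z, m, n, hm, hnm, hn⟩ := hJ.exists_union hsub (I := R')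
    (hJ.mem_of_le _ hI _ ((Cardinal.mk_subtype_le _).trans Cardinal.mk_range_le))
    (fun r => e r ≫ d r.1) (by
      intro r r' hne W g g' h
      exact hddisj (fun h => hne (Subtype.ext h)) (g ≫ e r) (g' ≫ e r') (by simpa using h))
  refine ⟨Z, m, hm, fun V v => ⟨?_, fun hv => ?_⟩⟩
  · rintro ⟨g, rfl⟩
    rw [F.map_op_comp_apply, F.map_op_comp_apply]
    congr 1
    refine (hF _ hn).ext fun W w hw => ?_
    obtain ⟨r, g, rfl⟩ := (Sieve.mem_ofArrows_iff _ _ _).1 hw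
    rw [← F.map_op_comp_apply, ← F.map_op_comp_apply, Category.assoc, hnm, ← Category.assoc]
    exact (he r _).1 ⟨g, rfl⟩
  · refine exists_map_eq_of_locally (F := yoneda.obj Y) (hsub Y).isSeparated (hsub Z) m
      (fun W u v h => (cancel_mono m).1 h) v (J.pullback_stable v hdcov) fun W w hw => ?_
    obtain ⟨r, g, hg⟩ := (Sieve.mem_ofArrows_iff _ _ _).1 hw
    have hgab : F.map (g ≫ d r).op a = F.map (g ≫ d r).op b := by
      rw [← hg, F.map_op_comp_apply, F.map_op_comp_apply, hv]
    by_cases hr : r.1.1 = r.1.2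
    · obtain ⟨h, hh⟩ := (he ⟨r, hr⟩ g).2 hgab
      refine ⟨h ≫ n ⟨r, hr⟩, ?_⟩
      change (h ≫ n ⟨r, hr⟩) ≫ m = w ≫ v
      rw [Category.assoc, hnm, hg, reassoc_of% hh]
    · refine exists_map_eq_of_locally (F := yoneda.obj Y) (hsub Y).isSeparated (hsub Z) m
        (fun W u v h => (cancel_mono m).1 h) _ (hdisj hr (g ≫ α' r) (g ≫ β' r) ?_)
        fun _ _ h => h.elim
      rw [F.map_op_comp_apply, F.map_op_comp_apply, hα', hβ', ← F.map_op_comp_apply,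
        ← F.map_op_comp_apply, hgab]

end IsSuperextensive

end Gluing

section Coproduct

variable {C : Type u} [SmallCategory C] {A : Type u} (X : A → C)

open Opposite

theorem sigma_ι_yoneda_app_surjective {W : C}
    (x : (∐ fun j => yoneda.obj (X j)).obj (op W)) :
    ∃ (j : A) (α : W ⟶ X j), (Sigma.ι (fun j => yoneda.obj (X j)) j).app (op W) α = x := by
  obtain ⟨⟨j⟩, α, hα⟩ := FunctorToTypes.jointly_surjective _ (op W)
    (coproductIsCoproduct fun j => yoneda.obj (X j)) x
  exact ⟨j, α, hα.symm⟩

/-- The presheaf whose sections over `W` are pairs of an index `j` and a morphism `W ⟶ X j`. -/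
def sigmaYoneda : Cᵒᵖ ⥤ Type u where
  obj W := Σ j, (W.unop ⟶ X j)
  map f := ↾fun x => ⟨x.1, f.unop ≫ x.2⟩

theorem sigma_ι_yoneda_app_injective {W : C} {j k : A} {α : W ⟶ X j} {β : W ⟶ X k}
    (h : (Sigma.ι (fun j => yoneda.obj (X j)) j).app (op W) α =
      (Sigma.ι (fun j => yoneda.obj (X j)) k).app (op W) β) :
    (⟨j, α⟩ : Σ j, (W ⟶ X j)) = ⟨k, β⟩ := by
  let t (j : A) : yoneda.obj (X j) ⟶ sigmaYoneda X := { app W := ↾fun α => ⟨j, α⟩ }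
  have ht (j : A) (α : W ⟶ X j) : (Sigma.desc t).app (op W)
      ((Sigma.ι (fun j => yoneda.obj (X j)) j).app (op W) α) = ⟨j, α⟩ := by
    rw [← comp_apply, ← NatTrans.comp_app, Sigma.ι_desc]
    rfl
  rw [← ht j α, h]
  exact ht k β

end Coproduct

section Sheafification

open Opposite

/-- On a superextensive subcanonical site, the locus where two sections of the sheafification of
a coproduct of representables agree is representable. -/
theorem IsSuperextensive.exists_mono_iff_sheafify_map_eq {C : Type u} [SmallCategory C]
    [HasFiniteLimits C] {J : GrothendieckTopology C} {κ : Set Cardinal.{u}}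
    (hJ : IsSuperextensive J κ) (hsub : ∀ X : C, Presieve.IsSheaf J (yoneda.obj X))
    {A : Type u} (X : A → C) {Y : C}
    (a b : (sheafify J (∐ fun j => yoneda.obj (X j))).obj (op Y)) :
    ∃ (Z : C) (m : Z ⟶ Y), Mono m ∧ ∀ ⦃V : C⦄ (f : V ⟶ Y),
      (∃ g, g ≫ m = f) ↔ (sheafify J (∐ fun j => yoneda.obj (X j))).map f.op a =
        (sheafify J (∐ fun j => yoneda.obj (X j))).map f.op b := by
  let P := ∐ fun j => yoneda.obj (X j)
  let ι (j : A) : yoneda.obj (X j) ⟶ P := Sigma.ι (fun j => yoneda.obj (X j)) j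
  let η : P ⟶ sheafify J P := toSheafify J P
  have hι (j) ⦃W W' : C⦄ (f : W' ⟶ W) (α : W ⟶ X j) :
      P.map f.op ((ι j).app (op W) α) = (ι j).app (op W') (f ≫ α) :=
    (NatTrans.naturality_apply (ι j) f.op α).symm
  have hs (j) ⦃W : C⦄ (α : W ⟶ X j) :
      (sheafify J P).map α.op (η.app _ ((ι j).app _ (𝟙 (X j)))) =
        η.app (op W) ((ι j).app (op W) α) := by
    rw [← NatTrans.naturality_apply, hι, Category.comp_id]
  have hcov {j k} ⦃W : C⦄ {α : W ⟶ X j} {β : W ⟶ X k}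
      (h : η.app (op W) ((ι j).app (op W) α) = η.app (op W) ((ι k).app (op W) β)) :
      ∃ T ∈ J W, ∀ ⦃V : C⦄ (f : V ⟶ W), T f →
        (⟨j, f ≫ α⟩ : Σ j, (V ⟶ X j)) = ⟨k, f ≫ β⟩ := by
    refine ⟨_, Presheaf.equalizerSieve_mem J η _ _ h, fun V f hf => ?_⟩
    replace hf : P.map f.op ((ι j).app (op W) α) = P.map f.op ((ι k).app (op W) β) := hf
    rw [hι, hι] at hf
    exact sigma_ι_yoneda_app_injective X hf
  refine hJ.exists_mono_iff_map_eq hsub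
    ((isSheaf_iff_isSheaf_of_type _ _).1
      ((presheafToSheaf J (Type u)).obj P).property).isSeparated
    (fun j => η.app _ ((ι j).app _ (𝟙 (X j)))) ?_ ?_ ?_ a b
  · refine fun V a => ⟨_, Presheaf.imageSieve_mem J η a, fun W f ⟨x, hx⟩ => ?_⟩
    obtain ⟨j, α, rfl⟩ := sigma_ι_yoneda_app_surjective X x
    exact ⟨j, α, (hs j α).trans hx⟩
  · intro j W α β h
    rw [hs, hs] at h
    obtain ⟨T, hT, hT'⟩ := hcov h
    exact hom_eq_of_locally (hsub _) hT fun V f hf => eq_of_heq (Sigma.mk.inj (hT' f hf)).2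
  · intro j k hjk W α β h
    rw [hs, hs] at h
    obtain ⟨T, hT, hT'⟩ := hcov h
    exact J.superset_covering (fun V f hf => hjk (congrArg Sigma.fst (hT' f hf))) hT

/-- If the morphisms `f : V ⟶ Y` along which the two components of `φ : L(h(Y)) ⟶ F ⨯ F` agree are
exactly those factoring through the monomorphism `m : Z ⟶ Y`, then `L(h(m))` is the pullback of
the diagonal of `F` along `φ`. -/
theorem isPullback_diag_of_mono {C : Type u} [SmallCategory C] {J : GrothendieckTopology C}
    (hsub : ∀ X : C, Presieve.IsSheaf J (yoneda.obj X)) {F : Sheaf J (Type u)} {Y Z : C}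
    (m : Z ⟶ Y) [Mono m]
    (φ : (presheafToSheaf J (Type u)).obj (yoneda.obj Y) ⟶ F ⨯ F)
    (hm : ∀ ⦃V : C⦄ (f : V ⟶ Y), (∃ g, g ≫ m = f) ↔
      (φ ≫ prod.fst).hom.app (op V) ((toSheafify J (yoneda.obj Y)).app (op V) f) =
      (φ ≫ prod.snd).hom.app (op V) ((toSheafify J (yoneda.obj Y)).app (op V) f)) :
    IsPullback ((presheafToSheaf J (Type u)).map (yoneda.map m))
      ((presheafToSheaf J (Type u)).map (yoneda.map m) ≫ φ ≫ prod.fst) φ (diag F) := by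
  have : ∀ X : C, IsIso (toSheafify J (yoneda.obj X)) := fun X =>
    isIso_toSheafify J ((isSheaf_iff_isSheaf_of_type _ _).2 (hsub X))
  have hbij (X V : C) : Function.Bijective ((toSheafify J (yoneda.obj X)).app (op V)) :=
    (isIso_iff_bijective _).1 inferInstance
  have hmap {V : C} (g : V ⟶ Z) : ((presheafToSheaf J (Type u)).map (yoneda.map m)).hom.app (op V)
      ((toSheafify J (yoneda.obj Z)).app (op V) g) =
      (toSheafify J (yoneda.obj Y)).app (op V) (g ≫ m) :=
    (ConcreteCategory.congr_hom
      (NatTrans.congr_app (toSheafify_naturality J (yoneda.map m)) (op V)) g).symm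
  have w : (presheafToSheaf J (Type u)).map (yoneda.map m) ≫ φ ≫ prod.fst =
      (presheafToSheaf J (Type u)).map (yoneda.map m) ≫ φ ≫ prod.snd := by
    apply Sheaf.hom_ext
    ext V x
    obtain ⟨g, rfl⟩ := (hbij Z V.unop).2 x
    have := (hm (g ≫ m)).1 ⟨g, rfl⟩
    rw [← hmap] at this
    exact this
  have comm : (presheafToSheaf J (Type u)).map (yoneda.map m) ≫ φ =
      ((presheafToSheaf J (Type u)).map (yoneda.map m) ≫ φ ≫ prod.fst) ≫ diag F := by
    apply prod.hom_ext
    · rw [Category.assoc, Category.assoc, prod.lift_fst, Category.comp_id]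
    · rw [Category.assoc, Category.assoc, prod.lift_snd, Category.comp_id, w]
  refine IsPullback.of_map (sheafToPresheaf J (Type u)) comm
    (IsPullback.of_forall_isPullback_app fun V => (Types.isPullback_iff _ _ _ _).2 ⟨?_, ?_, ?_⟩)
  · exact NatTrans.congr_app (congrArg (sheafToPresheaf J (Type u)).map comm) V
  · rintro x₁ x₂ ⟨h, -⟩
    obtain ⟨g₁, rfl⟩ := (hbij Z V.unop).2 x₁
    obtain ⟨g₂, rfl⟩ := (hbij Z V.unop).2 x₂
    have := (hbij Y V.unop).1 ((hmap g₁).symm.trans (h.trans (hmap g₂)))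
    rw [(cancel_mono m).1 this]
  · intro x y h
    obtain ⟨f, rfl⟩ := (hbij Y V.unop).2 x
    replace h : φ.hom.app V ((toSheafify J (yoneda.obj Y)).app V f) = (diag F).hom.app V y := h
    have comp {G : Sheaf J (Type u)} (π : F ⨯ F ⟶ G) :
        (φ ≫ π).hom.app V ((toSheafify J (yoneda.obj Y)).app V f) =
          (diag F ≫ π).hom.app V y :=
      congrArg (π.hom.app V) h
    have h₁ := comp prod.fst
    have h₂ := comp prod.snd
    rw [prod.lift_fst] at h₁
    rw [prod.lift_snd] at h₂
    obtain ⟨g, rfl⟩ := (hm f).2 (h₁.trans h₂.symm)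
    refine ⟨(toSheafify J (yoneda.obj Z)).app V g, hmap g, ?_⟩
    exact (congrArg ((φ ≫ prod.fst).hom.app V) (hmap g)).trans h₁

end Sheafification

/-- Let `S` be a small category with finite limits, equipped with a
subcanonical Grothendieck pretopology `K`, and let `κ` be a family of cardinals closed under
decomposition.  Assume `S` is `κ`-superextensive: (1) every covering family contains a
covering subfamily of cardinality in `κ`; (2) coproducts of families of cardinality in `κ`
exist, are disjoint and universal, and the corresponding families of coproduct inclusions
are coverings.  Then `S` is geometric: for every small family `(X_j)` of objects, setting
`F := L(⨿_j h(X_j))`, for every `Y ∈ S` and every morphism of sheaves `Lh(Y) → F × F`, the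
fiber product `Lh(Y) ×_{F×F} F` along the diagonal of `F` is representable. -/
theorem statement12 {S : Type u} [SmallCategory S] [HasFiniteLimits S]
    (K : Pretopology S)
    (hsub : ∀ X : S, Presieve.IsSheaf K.toGrothendieck (yoneda.obj X))
    (κ : Set Cardinal.{u})
    (hκdown : ∀ c ∈ κ, ∀ c' ≤ c, c' ∈ κ)
    (hrefine : ∀ (X : S) (R : Presieve X), R ∈ K X →
      ∃ R' : Presieve X, R' ∈ K X ∧ (∀ ⦃Y : S⦄ (f : Y ⟶ X), R' f → R f) ∧
        Cardinal.mk (Σ Y : S, { f : Y ⟶ X // R' f }) ∈ κ)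
    (hext : ∀ (J : Type u) (Xf : J → S), Cardinal.mk J ∈ κ →
      ∃ (c : Cofan Xf) (_ : IsColimit c),
        (∀ j, Mono (c.inj j)) ∧
        (∀ j j' : J, j ≠ j' →
          Nonempty (IsInitial (pullback (c.inj j) (c.inj j')))) ∧
        IsUniversalColimit c ∧
        Presieve.ofArrows Xf c.inj ∈ K c.pt) :
    ∀ (J : Type u) (Xf : J → S) (Y : S)
      (φ : (presheafToSheaf K.toGrothendieck (Type u)).obj (yoneda.obj Y) ⟶
        (presheafToSheaf K.toGrothendieck (Type u)).obj (∐ fun j => yoneda.obj (Xf j)) ⨯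
          (presheafToSheaf K.toGrothendieck (Type u)).obj (∐ fun j => yoneda.obj (Xf j))),
      ∃ Z : S, Nonempty
        (pullback φ
            (diag ((presheafToSheaf K.toGrothendieck (Type u)).obj
              (∐ fun j => yoneda.obj (Xf j)))) ≅
          (presheafToSheaf K.toGrothendieck (Type u)).obj (yoneda.obj Z)) := by
  have hJ : IsSuperextensive K.toGrothendieck κ := by
    refine ⟨hκdown, fun V T hT => ?_, fun I X hI => ?_⟩
    · obtain ⟨R, hR, hRT⟩ := hT
      obtain ⟨R', hR', hle, hκ⟩ := hrefine V R hR
      refine ⟨_, fun i : Σ Y : S, { f : Y ⟶ V // R' f } => i.1, fun i => i.2.1, hκ,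
        ⟨R', hR', fun W f hf => ?_⟩, fun i => hRT _ _ (hle _ i.2.2)⟩
      exact Sieve.ofArrows_mk _ _ (⟨W, f, hf⟩ : Σ Y : S, { f : Y ⟶ V // R' f })
    · obtain ⟨c, hc, hmono, hdisj, -, hcov⟩ := hext I X hI
      refine ⟨c, ⟨hc⟩, hmono, fun i i' hne W g g' e => ?_, _, hcov, Sieve.le_generate _⟩
      obtain ⟨hinit⟩ := hdisj i i' hne
      obtain ⟨R, hR, -, hκ⟩ := hrefine W _ (K.has_isos (𝟙 W))
      obtain ⟨z, -, -, -, -, hzcov⟩ := hext PEmpty PEmpty.elim (hκdown _ hκ _ (by simp))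
      refine K.toGrothendieck.superset_covering ?_ (K.toGrothendieck.pullback_stable
        (pullback.lift g g' e ≫ hinit.to z.pt) ⟨_, hzcov, Sieve.le_generate _⟩)
      rintro V f ⟨_, _, _, ⟨i⟩, _⟩
      exact i.elim
  intro J Xf Y φ
  let η := toSheafify K.toGrothendieck (yoneda.obj Y)
  obtain ⟨Z, m, hm, h⟩ := hJ.exists_mono_iff_sheafify_map_eq hsub Xf
    ((φ ≫ prod.fst).hom.app (.op Y) (η.app (.op Y) (𝟙 Y)))
    ((φ ≫ prod.snd).hom.app (.op Y) (η.app (.op Y) (𝟙 Y)))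
  refine ⟨Z, ⟨(isPullback_diag_of_mono hsub m φ fun V f => (h f).trans ?_).isoPullback.symm⟩⟩
  have key (ψ : (presheafToSheaf K.toGrothendieck (Type u)).obj (yoneda.obj Y) ⟶
      (presheafToSheaf K.toGrothendieck (Type u)).obj (∐ fun j => yoneda.obj (Xf j))) :
      (sheafify K.toGrothendieck (∐ fun j => yoneda.obj (Xf j))).map f.op
        (ψ.hom.app (.op Y) (η.app (.op Y) (𝟙 Y))) = ψ.hom.app (.op V) (η.app (.op V) f) := by
    refine (NatTrans.naturality_apply ψ.hom f.op _).symm.trans (congrArg (ψ.hom.app (.op V)) ?_)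
    refine (NatTrans.naturality_apply η f.op _).symm.trans (congrArg (η.app (.op V)) ?_)
    exact Category.comp_id f
  rw [key, key]
end

section
/- Let I be a small category and S₀ : tw I → Set an admissible functor. Then: (a) there is a well-defined category ∫̃_I S₀ whose objects are pairs (i, x) with i an object of I and x ∈ S₀(id_i), and whose morphisms (i, x) → (i', x') are pairs (φ : i → i', y ∈ S₀(φ)) with s(y) = x and t(y) = x'; the composite of (φ, y) : (i, x) → (i', x') and (φ', y') : (i', x') → (i'', x'') is (φ' ∘ φ, y''), where y'' is the unique element of S₀(φ' ∘ φ) mapping to y under the type-2 morphism φ' ∘ φ → φ and to y' under the type-1 morphism φ' ∘ φ → φ' (existence and uniqueness of y'' hold by admissibility). (b) There is an isomorphism of categories tw(∫̃_I S₀) ≅ ∫_{tw I} S₀ between the twisted arrow category of ∫̃_I S₀ and the category of elements of S₀, sending the object of tw(∫̃_I S₀) given by a morphism (i, x) → (i', x') with datum (φ, y) to the element (φ, y) of ∫_{tw I} S₀. -/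
open CategoryTheory

universe w v u

namespace Paper

/-- A morphism of a category is *an identity* if its source and target are equal and it is
the corresponding identity morphism. -/
def IsIdentityMor {C : Type u} [Category.{v} C] {i j : C} (f : i ⟶ j) : Prop :=
  ∃ h : i = j, f = eqToHom h

theorem isIdentityMor_id {C : Type u} [Category.{v} C] (i : C) : IsIdentityMor (𝟙 i) :=
  ⟨rfl, by simp⟩

/-- Objects of the twisted arrow category `tw I` (paper's convention): morphisms of `I`. -/
structure TwObj (I : Type u) [Category.{v} I] : Type (max u v) where
  {src : I}
  {tgt : I}
  hom : src ⟶ tgt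

variable {I : Type u} [Category.{v} I]

/-- The object of `tw I` corresponding to a morphism of `I`. -/
def twMk {i j : I} (f : i ⟶ j) : TwObj I := ⟨f⟩

@[simp] theorem twMk_src {i j : I} (f : i ⟶ j) : (twMk f).src = i := rfl
@[simp] theorem twMk_tgt {i j : I} (f : i ⟶ j) : (twMk f).tgt = j := rfl
@[simp] theorem twMk_hom {i j : I} (f : i ⟶ j) : (twMk f).hom = f := rfl

/-- Morphisms of `tw I`: a morphism from `f : i₁ → i₂` to `g : i₁' → i₂'` is a pair
`(a : i₁ → i₁', b : i₂' → i₂)` with `f = b ∘ g ∘ a`. -/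
@[ext]
structure TwHom (f g : TwObj I) : Type v where
  a : f.src ⟶ g.src
  b : g.tgt ⟶ f.tgt
  w : f.hom = a ≫ g.hom ≫ b := by aesop_cat

attribute [simp] TwHom.w

instance : Category (TwObj I) where
  Hom := TwHom
  id f := { a := 𝟙 _, b := 𝟙 _ }
  comp φ ψ :=
    { a := φ.a ≫ ψ.a, b := ψ.b ≫ φ.b,
      w := by rw [φ.w, ψ.w]; simp }
  id_comp := by intros; apply TwHom.ext <;> simp
  comp_id := by intros; apply TwHom.ext <;> simp
  assoc := by intros; apply TwHom.ext <;> simp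

@[simp] theorem twComp_a {f g h : TwObj I} (θ : f ⟶ g) (θ' : g ⟶ h) :
    (θ ≫ θ').a = θ.a ≫ θ'.a := rfl

@[simp] theorem twComp_b {f g h : TwObj I} (θ : f ⟶ g) (θ' : g ⟶ h) :
    (θ ≫ θ').b = θ'.b ≫ θ.b := rfl

@[simp] theorem twId_a (f : TwObj I) : TwHom.a (𝟙 f) = 𝟙 f.src := rfl

@[simp] theorem twId_b (f : TwObj I) : TwHom.b (𝟙 f) = 𝟙 f.tgt := rfl

/-- The type-2 morphism `φ → id_i` in `tw I`, inducing `s : S₀(φ) → S₀(id_i)`. -/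
def sArrow {i j : I} (φ : i ⟶ j) : twMk φ ⟶ twMk (𝟙 i) :=
  { a := 𝟙 i, b := φ, w := by simp [twMk] }

/-- The type-1 morphism `φ → id_{i'}` in `tw I`, inducing `t : S₀(φ) → S₀(id_{i'})`. -/
def tArrow {i j : I} (φ : i ⟶ j) : twMk φ ⟶ twMk (𝟙 j) :=
  { a := φ, b := 𝟙 j, w := by simp [twMk] }

@[simp] theorem sArrow_a {i j : I} (φ : i ⟶ j) : (sArrow φ).a = 𝟙 i := rfl
@[simp] theorem sArrow_b {i j : I} (φ : i ⟶ j) : (sArrow φ).b = φ := rfl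
@[simp] theorem tArrow_a {i j : I} (φ : i ⟶ j) : (tArrow φ).a = φ := rfl
@[simp] theorem tArrow_b {i j : I} (φ : i ⟶ j) : (tArrow φ).b = 𝟙 j := rfl

/-- The type-2 morphism `(φ ≫ ψ) → φ` in `tw I`. -/
def compToLeft {i j k : I} (φ : i ⟶ j) (ψ : j ⟶ k) : twMk (φ ≫ ψ) ⟶ twMk φ :=
  { a := 𝟙 i, b := ψ, w := by simp [twMk] }

/-- The type-1 morphism `(φ ≫ ψ) → ψ` in `tw I`. -/
def compToRight {i j k : I} (φ : i ⟶ j) (ψ : j ⟶ k) : twMk (φ ≫ ψ) ⟶ twMk ψ :=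
  { a := φ, b := 𝟙 k, w := by simp [twMk] }

@[simp] theorem compToLeft_a {i j k : I} (φ : i ⟶ j) (ψ : j ⟶ k) :
    (compToLeft φ ψ).a = 𝟙 i := rfl
@[simp] theorem compToLeft_b {i j k : I} (φ : i ⟶ j) (ψ : j ⟶ k) :
    (compToLeft φ ψ).b = ψ := rfl
@[simp] theorem compToRight_a {i j k : I} (φ : i ⟶ j) (ψ : j ⟶ k) :
    (compToRight φ ψ).a = φ := rfl
@[simp] theorem compToRight_b {i j k : I} (φ : i ⟶ j) (ψ : j ⟶ k) :
    (compToRight φ ψ).b = 𝟙 k := rfl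

/-- A functor `S₀ : tw I → Set` is *admissible* if every square in `tw I` whose horizontal
morphisms are of type 2 (first component an identity) and whose vertical morphisms are of
type 1 (second component an identity) is sent to a pullback square of sets. -/
def Admissible (S₀ : TwObj I ⥤ Type w) : Prop :=
  ∀ ⦃W X Y Z : TwObj I⦄ (θ₁ : W ⟶ X) (θ₂ : W ⟶ Y) (θ₃ : X ⟶ Z) (θ₄ : Y ⟶ Z),
    IsIdentityMor θ₁.a → IsIdentityMor θ₂.b → IsIdentityMor θ₃.b → IsIdentityMor θ₄.a →
    θ₁ ≫ θ₃ = θ₂ ≫ θ₄ →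
    ∀ (ex : S₀.obj X) (ey : S₀.obj Y), S₀.map θ₃ ex = S₀.map θ₄ ey →
      ∃! ew : S₀.obj W, S₀.map θ₁ ew = ex ∧ S₀.map θ₂ ew = ey

variable (S₀ : TwObj I ⥤ Type w)

/-- Objects of `∫̃_I S₀`: pairs `(i, x)` with `i` an object of `I` and `x ∈ S₀(id_i)`. -/
def IntObj : Type max u w := Σ i : I, S₀.obj (twMk (𝟙 i))

/-- Morphisms `(i, x) → (i', x')` of `∫̃_I S₀`: pairs `(φ : i → i', y ∈ S₀(φ))` with
`s(y) = x` and `t(y) = x'`. -/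
def IntHom (x y : IntObj S₀) : Type max v w :=
  { q : Σ φ : x.1 ⟶ y.1, S₀.obj (twMk φ) //
      S₀.map (sArrow q.1) q.2 = x.2 ∧ S₀.map (tArrow q.1) q.2 = y.2 }

variable {S₀}

/-- The identity morphism `(id_i, x)` of `∫̃_I S₀` at `(i, x)`. -/
def intId (x : IntObj S₀) : IntHom S₀ x x :=
  ⟨⟨𝟙 x.1, x.2⟩, by
      have hs : sArrow (𝟙 x.1) = 𝟙 (twMk (𝟙 x.1)) := by apply TwHom.ext <;> simp
      have ht : tArrow (𝟙 x.1) = 𝟙 (twMk (𝟙 x.1)) := by apply TwHom.ext <;> simp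
      rw [hs, ht]
      simp⟩

/-- The composition of `∫̃_I S₀`:  `(φ, y) ≫ (φ', y') = (φ ≫ φ', y'')` where `y''` is the
unique element of `S₀(φ ≫ φ')` mapping to `y` under the type-2 morphism `(φ ≫ φ') → φ` and
to `y'` under the type-1 morphism `(φ ≫ φ') → φ'`; existence and uniqueness hold by
admissibility. -/
noncomputable def intComp (hadm : Admissible S₀) {x y z : IntObj S₀}
    (f : IntHom S₀ x y) (g : IntHom S₀ y z) : IntHom S₀ x z :=
  have hu : ∃! e : S₀.obj (twMk (f.1.1 ≫ g.1.1)),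
      S₀.map (compToLeft f.1.1 g.1.1) e = f.1.2 ∧
        S₀.map (compToRight f.1.1 g.1.1) e = g.1.2 :=
    hadm (compToLeft f.1.1 g.1.1) (compToRight f.1.1 g.1.1) (tArrow f.1.1) (sArrow g.1.1)
      (by simp [isIdentityMor_id]) (by simp [isIdentityMor_id])
      (by simp [isIdentityMor_id]) (by simp [isIdentityMor_id])
      (by apply TwHom.ext <;> simp)
      f.1.2 g.1.2 (f.2.2.trans g.2.1.symm)
  ⟨⟨f.1.1 ≫ g.1.1, hu.exists.choose⟩, by
      constructor
      · have hs : sArrow (f.1.1 ≫ g.1.1) = compToLeft f.1.1 g.1.1 ≫ sArrow f.1.1 := by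
          apply TwHom.ext <;> simp
        rw [hs, FunctorToTypes.map_comp_apply, hu.exists.choose_spec.1]
        exact f.2.1
      · have ht : tArrow (f.1.1 ≫ g.1.1) = compToRight f.1.1 g.1.1 ≫ tArrow g.1.1 := by
          apply TwHom.ext <;> simp
        rw [ht, FunctorToTypes.map_comp_apply, hu.exists.choose_spec.2]
        exact g.2.2⟩

/-- The category structure (objects, morphisms, identities, composition) of `∫̃_I S₀`. -/
noncomputable def intStruct (hadm : Admissible S₀) : CategoryStruct.{max v w} (IntObj S₀) where
  Hom := IntHom S₀
  id := intId
  comp f g := intComp hadm f g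

/-- Transport of a morphism of the prescribed categorical structure to a morphism of a
category whose underlying structure is equal to it. -/
def homOfStructEq {α : Type*} [inst : Category α] {struc : CategoryStruct α}
    (h : inst.toCategoryStruct = struc) {x y : α}
    (q : @Quiver.Hom α struc.toQuiver x y) : x ⟶ y := by
  subst h; exact q

/-- Part (b) of Statement 13: the twisted arrow category of `∫̃_I S₀` is isomorphic, as a
category (via mutually inverse functors), to the category of elements `∫_{tw I} S₀`, the
isomorphism sending the object of `tw (∫̃_I S₀)` given by a morphism with datum `(φ, y)` to
the element `(φ, y)`. -/
def PartB (S₀ : TwObj I ⥤ Type w) (hadm : Admissible S₀)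
    [inst : Category.{max v w} (IntObj S₀)]
    (hstruct : inst.toCategoryStruct = intStruct hadm) : Prop :=
  ∃ (Φ : TwObj (IntObj S₀) ⥤ S₀.Elements) (Ψ : S₀.Elements ⥤ TwObj (IntObj S₀)),
    Φ ⋙ Ψ = 𝟭 (TwObj (IntObj S₀)) ∧ Ψ ⋙ Φ = 𝟭 S₀.Elements ∧
    ∀ (x y : IntObj S₀) (q : IntHom S₀ x y),
      Φ.obj ⟨homOfStructEq hstruct q⟩ = ⟨twMk q.1.1, q.1.2⟩

/-- A fully faithful functor that is bijective on objects has a strict inverse. -/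
theorem exists_strict_inverse {C D : Type*} [Category* C] [Category* D] (F : C ⥤ D)
    [F.Full] [F.Faithful] (hF : Function.Bijective F.obj) :
    ∃ G : D ⥤ C, F ⋙ G = 𝟭 C ∧ G ⋙ F = 𝟭 D := by
  obtain ⟨g, hgF, hFg⟩ := Function.bijective_iff_has_inverse.mp hF
  let G : D ⥤ C :=
    { obj := g
      map := fun {X Y} f => F.preimage (eqToHom (hFg X) ≫ f ≫ eqToHom (hFg Y).symm)
      map_id := fun X => F.map_injective (by simp)
      map_comp := fun f f' => F.map_injective (by simp) }
  refine ⟨G, CategoryTheory.Functor.ext hgF fun X Y f => F.map_injective ?_,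
    CategoryTheory.Functor.ext hFg fun X Y f => ?_⟩
  · simp [G, eqToHom_map]
  · simp [G]

theorem TwObj.hom_ext {f g : TwObj I} {θ θ' : f ⟶ g} (ha : θ.a = θ'.a) (hb : θ.b = θ'.b) :
    θ = θ' :=
  TwHom.ext ha hb

theorem map_map_eq_map {f g h : TwObj I} {θ : f ⟶ g} {θ' : g ⟶ h} {τ : f ⟶ h}
    (ha : θ.a ≫ θ'.a = τ.a) (hb : θ'.b ≫ θ.b = τ.b) (e : S₀.obj f) :
    S₀.map θ' (S₀.map θ e) = S₀.map τ e := by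
  obtain rfl : θ ≫ θ' = τ := TwObj.hom_ext ha hb
  exact (S₀.map_comp_apply θ θ' e).symm

theorem IntHom.ext_of_map {x y : IntObj S₀} {f g : IntHom S₀ x y}
    (θ : twMk f.1.1 ⟶ twMk g.1.1) (ha : θ.a = 𝟙 x.1) (hb : θ.b = 𝟙 y.1)
    (h : S₀.map θ f.1.2 = g.1.2) : f = g := by
  obtain ⟨⟨φ, e⟩, hf⟩ := f
  obtain ⟨⟨ψ, e'⟩, hg⟩ := g
  obtain rfl : φ = ψ := by
    have := θ.w
    rw [ha, hb] at this
    simpa using this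
  obtain rfl : θ = 𝟙 _ := TwObj.hom_ext ha hb
  obtain rfl : e = e' := by simpa using h
  rfl

/-- An element over a composite is determined by its images over the two factors. -/
theorem Admissible.elem_ext (hadm : Admissible S₀) {i j k : I} {φ : i ⟶ j} {ψ : j ⟶ k}
    {e e' : S₀.obj (twMk (φ ≫ ψ))}
    (hl : S₀.map (compToLeft φ ψ) e = S₀.map (compToLeft φ ψ) e')
    (hr : S₀.map (compToRight φ ψ) e = S₀.map (compToRight φ ψ) e') : e = e' := by
  have hsq : compToLeft φ ψ ≫ tArrow φ = compToRight φ ψ ≫ sArrow ψ :=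
    TwObj.hom_ext (by simp) (by simp)
  refine (hadm (compToLeft φ ψ) (compToRight φ ψ) (tArrow φ) (sArrow ψ)
    (isIdentityMor_id _) (isIdentityMor_id _) (isIdentityMor_id _) (isIdentityMor_id _) hsq
    (S₀.map (compToLeft φ ψ) e') (S₀.map (compToRight φ ψ) e') ?_).unique
    ⟨hl, hr⟩ ⟨rfl, rfl⟩
  rw [← Functor.map_comp_apply, ← Functor.map_comp_apply, hsq]

theorem intComp_snd_spec (hadm : Admissible S₀) {x y z : IntObj S₀} (f : IntHom S₀ x y)
    (g : IntHom S₀ y z) :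
    S₀.map (compToLeft f.1.1 g.1.1) (intComp hadm f g).1.2 = f.1.2 ∧
      S₀.map (compToRight f.1.1 g.1.1) (intComp hadm f g).1.2 = g.1.2 := by
  unfold intComp
  generalize_proofs h
  exact h.exists.choose_spec

theorem map_left_of_eq_intComp (hadm : Admissible S₀) {x y z : IntObj S₀} {f : IntHom S₀ x y}
    {g : IntHom S₀ y z} {h : IntHom S₀ x z} (hh : h = intComp hadm f g)
    (θ : twMk h.1.1 ⟶ twMk f.1.1) (ha : θ.a = 𝟙 x.1) (hb : θ.b = g.1.1) :
    S₀.map θ h.1.2 = f.1.2 := by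
  subst hh
  obtain rfl : θ = compToLeft f.1.1 g.1.1 := TwObj.hom_ext ha hb
  exact (intComp_snd_spec hadm f g).1

theorem map_right_of_eq_intComp (hadm : Admissible S₀) {x y z : IntObj S₀} {f : IntHom S₀ x y}
    {g : IntHom S₀ y z} {h : IntHom S₀ x z} (hh : h = intComp hadm f g)
    (θ : twMk h.1.1 ⟶ twMk g.1.1) (ha : θ.a = f.1.1) (hb : θ.b = 𝟙 z.1) :
    S₀.map θ h.1.2 = g.1.2 := by
  subst hh
  obtain rfl : θ = compToRight f.1.1 g.1.1 := TwObj.hom_ext ha hb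
  exact (intComp_snd_spec hadm f g).2

theorem eq_intComp_snd (hadm : Admissible S₀) {x y z : IntObj S₀} {f : IntHom S₀ x y}
    {g : IntHom S₀ y z} {e : S₀.obj (twMk (f.1.1 ≫ g.1.1))}
    (hl : S₀.map (compToLeft f.1.1 g.1.1) e = f.1.2)
    (hr : S₀.map (compToRight f.1.1 g.1.1) e = g.1.2) :
    e = (intComp hadm f g).1.2 :=
  hadm.elem_ext (hl.trans (intComp_snd_spec hadm f g).1.symm)
    (hr.trans (intComp_snd_spec hadm f g).2.symm)

theorem eq_intComp (hadm : Admissible S₀) {x y z : IntObj S₀} {f : IntHom S₀ x y}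
    {g : IntHom S₀ y z} {h : IntHom S₀ x z}
    (θl : twMk h.1.1 ⟶ twMk f.1.1) (hla : θl.a = 𝟙 x.1) (hlb : θl.b = g.1.1)
    (hl : S₀.map θl h.1.2 = f.1.2)
    (θr : twMk h.1.1 ⟶ twMk g.1.1) (hra : θr.a = f.1.1) (hrb : θr.b = 𝟙 z.1)
    (hr : S₀.map θr h.1.2 = g.1.2) :
    h = intComp hadm f g := by
  have hφ : h.1.1 = f.1.1 ≫ g.1.1 := by
    have := θl.w
    rw [hla, hlb] at this
    simpa using this
  let θ : twMk h.1.1 ⟶ twMk (f.1.1 ≫ g.1.1) := { a := 𝟙 x.1, b := 𝟙 z.1, w := by simp [hφ] }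
  refine IntHom.ext_of_map (g := intComp hadm f g) θ rfl rfl (eq_intComp_snd hadm ?_ ?_)
  · exact (map_map_eq_map ((Category.comp_id _).trans hla.symm)
      ((Category.comp_id _).trans hlb.symm) _).trans hl
  · exact (map_map_eq_map ((Category.id_comp _).trans hra.symm)
      ((Category.comp_id _).trans hrb.symm) _).trans hr

theorem intId_comp (hadm : Admissible S₀) {x y : IntObj S₀} (f : IntHom S₀ x y) :
    intComp hadm (intId x) f = f :=
  (eq_intComp hadm (sArrow f.1.1) rfl rfl f.2.1 (𝟙 _) rfl rfl (by simp)).symm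

theorem intComp_id (hadm : Admissible S₀) {x y : IntObj S₀} (f : IntHom S₀ x y) :
    intComp hadm f (intId y) = f :=
  (eq_intComp hadm (𝟙 _) rfl rfl (by simp) (tArrow f.1.1) rfl rfl f.2.2).symm

theorem intComp_assoc (hadm : Admissible S₀) {x y z t : IntObj S₀} (f : IntHom S₀ x y)
    (g : IntHom S₀ y z) (h : IntHom S₀ z t) :
    intComp hadm (intComp hadm f g) h = intComp hadm f (intComp hadm g h) := by
  obtain ⟨hfgl, hfgr⟩ := intComp_snd_spec hadm f g
  obtain ⟨hl, hr⟩ := intComp_snd_spec hadm (intComp hadm f g) h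
  let θr : twMk ((f.1.1 ≫ g.1.1) ≫ h.1.1) ⟶ twMk (g.1.1 ≫ h.1.1) :=
    { a := f.1.1, b := 𝟙 t.1, w := by simp }
  refine eq_intComp hadm
    (compToLeft (f.1.1 ≫ g.1.1) h.1.1 ≫ compToLeft f.1.1 g.1.1) (Category.comp_id _) rfl ?_
    θr rfl rfl (eq_intComp_snd hadm ?_ ?_)
  · exact (S₀.map_comp_apply _ _ _).trans ((congrArg _ hl).trans hfgl)
  · refine Eq.trans ?_ ((congrArg (S₀.map (compToRight f.1.1 g.1.1)) hl).trans hfgr)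
    exact (map_map_eq_map (τ := compToLeft (f.1.1 ≫ g.1.1) h.1.1 ≫ compToRight f.1.1 g.1.1)
      ((Category.comp_id _).trans (Category.id_comp _).symm)
      ((Category.comp_id _).trans (Category.id_comp _).symm) _).trans (S₀.map_comp_apply _ _ _)
  · exact (map_map_eq_map (τ := compToRight (f.1.1 ≫ g.1.1) h.1.1) rfl
      (Category.comp_id _) _).trans hr

/-- The category `∫̃_I S₀`. -/
noncomputable instance intCategory [hadm : Fact (Admissible S₀)] :
    Category.{max v w} (IntObj S₀) where
  toCategoryStruct := intStruct hadm.out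
  id_comp := intId_comp hadm.out
  comp_id := intComp_id hadm.out
  assoc := intComp_assoc hadm.out

section

variable [hadm : Fact (Admissible S₀)]

/-- The morphism of `∫̃_I S₀` underlying an object of its twisted arrow category. -/
def TwObj.intHom (q : TwObj (IntObj S₀)) : IntHom S₀ q.src q.tgt := q.hom

/-- The first component of a morphism of `tw (∫̃_I S₀)`, as a morphism of `∫̃_I S₀`. -/
def TwHom.intA {q q' : TwObj (IntObj S₀)} (θ : q ⟶ q') : IntHom S₀ q.src q'.src := θ.a

/-- The second component of a morphism of `tw (∫̃_I S₀)`, as a morphism of `∫̃_I S₀`. -/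
def TwHom.intB {q q' : TwObj (IntObj S₀)} (θ : q ⟶ q') : IntHom S₀ q'.tgt q.tgt := θ.b

theorem TwHom.int_w {q q' : TwObj (IntObj S₀)} (θ : q ⟶ q') :
    q.intHom = intComp hadm.out (intA θ) (intComp hadm.out q'.intHom (intB θ)) :=
  θ.w

theorem TwHom.int_w_fst {q q' : TwObj (IntObj S₀)} (θ : q ⟶ q') :
    q.intHom.1.1 = (intA θ).1.1 ≫ q'.intHom.1.1 ≫ (intB θ).1.1 :=
  congrArg (fun f : IntHom S₀ _ _ => f.1.1) (int_w θ)

/-- The morphism of `tw I` underlying a morphism of `tw (∫̃_I S₀)`. -/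
def TwHom.toBase {q q' : TwObj (IntObj S₀)} (θ : q ⟶ q') :
    twMk q.intHom.1.1 ⟶ twMk q'.intHom.1.1 where
  a := (intA θ).1.1
  b := (intB θ).1.1
  w := int_w_fst θ

theorem TwHom.map_to_middle {q q' : TwObj (IntObj S₀)} (θ : q ⟶ q') :
    S₀.map ({ a := (intA θ).1.1, b := 𝟙 q.tgt.1, w := by simpa using int_w_fst θ } :
      TwHom (twMk q.intHom.1.1) (twMk (q'.intHom.1.1 ≫ (intB θ).1.1))) q.intHom.1.2 =
        (intComp hadm.out q'.intHom (intB θ)).1.2 :=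
  map_right_of_eq_intComp hadm.out (int_w θ) _ rfl rfl

theorem TwHom.map_toBase {q q' : TwObj (IntObj S₀)} (θ : q ⟶ q') :
    S₀.map (toBase θ) q.intHom.1.2 = q'.intHom.1.2 := by
  rw [← (intComp_snd_spec hadm.out q'.intHom (intB θ)).1, ← map_to_middle θ]
  exact (map_map_eq_map (Category.comp_id _) (Category.comp_id _) _).symm

theorem TwHom.map_to_intA {q q' : TwObj (IntObj S₀)} (θ : q ⟶ q')
    (p : twMk q.intHom.1.1 ⟶ twMk (intA θ).1.1) (ha : p.a = 𝟙 q.src.1)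
    (hb : p.b = q'.intHom.1.1 ≫ (intB θ).1.1) : S₀.map p q.intHom.1.2 = (intA θ).1.2 :=
  map_left_of_eq_intComp hadm.out (int_w θ) p ha hb

theorem TwHom.map_to_intB {q q' : TwObj (IntObj S₀)} (θ : q ⟶ q')
    (p : twMk q.intHom.1.1 ⟶ twMk (intB θ).1.1) (ha : p.a = (intA θ).1.1 ≫ q'.intHom.1.1)
    (hb : p.b = 𝟙 q.tgt.1) : S₀.map p q.intHom.1.2 = (intB θ).1.2 := by
  rw [← (intComp_snd_spec hadm.out q'.intHom (intB θ)).2, ← map_to_middle θ]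
  exact (map_map_eq_map ha.symm ((Category.comp_id _).trans hb.symm) _).symm

theorem TwHom.toBase_injective {q q' : TwObj (IntObj S₀)} {θ θ' : q ⟶ q'}
    (h : toBase θ = toBase θ') : θ = θ' := by
  have ha : (intA θ).1.1 = (intA θ').1.1 := congrArg TwHom.a h
  have hb : (intB θ).1.1 = (intB θ').1.1 := congrArg TwHom.b h
  apply TwObj.hom_ext
  · let p : twMk q.intHom.1.1 ⟶ twMk (intA θ).1.1 :=
      { a := 𝟙 q.src.1, b := q'.intHom.1.1 ≫ (intB θ).1.1, w := by simpa using int_w_fst θ }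
    let c : twMk (intA θ).1.1 ⟶ twMk (intA θ').1.1 :=
      { a := 𝟙 q.src.1, b := 𝟙 q'.src.1, w := by simp [ha] }
    refine IntHom.ext_of_map (f := intA θ) (g := intA θ') c rfl rfl ?_
    rw [← map_to_intA θ p rfl rfl, ← Functor.map_comp_apply]
    exact map_to_intA θ' _ (Category.comp_id _) ((Category.id_comp _).trans (congrArg (_ ≫ ·) hb))
  · let p : twMk q.intHom.1.1 ⟶ twMk (intB θ).1.1 :=
      { a := (intA θ).1.1 ≫ q'.intHom.1.1, b := 𝟙 q.tgt.1, w := by simpa using int_w_fst θ }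
    let c : twMk (intB θ).1.1 ⟶ twMk (intB θ').1.1 :=
      { a := 𝟙 q'.tgt.1, b := 𝟙 q.tgt.1, w := by simp [hb] }
    refine IntHom.ext_of_map (f := intB θ) (g := intB θ') c rfl rfl ?_
    rw [← map_to_intB θ p rfl rfl, ← Functor.map_comp_apply]
    exact map_to_intB θ' _ ((Category.comp_id _).trans (congrArg (· ≫ _) ha)) (Category.id_comp _)

theorem TwHom.toBase_surjective {q q' : TwObj (IntObj S₀)}
    (τ : twMk q.intHom.1.1 ⟶ twMk q'.intHom.1.1)
    (hτ : S₀.map τ q.intHom.1.2 = q'.intHom.1.2) : ∃ θ : q ⟶ q', toBase θ = τ := by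
  have hw : q.intHom.1.1 = τ.a ≫ q'.intHom.1.1 ≫ τ.b := τ.w
  let pa : twMk q.intHom.1.1 ⟶ twMk (i := q.src.1) (j := q'.src.1) τ.a :=
    { a := 𝟙 q.src.1, b := q'.intHom.1.1 ≫ τ.b, w := hw.trans (Category.id_comp _).symm }
  let pb : twMk q.intHom.1.1 ⟶ twMk (i := q'.tgt.1) (j := q.tgt.1) τ.b :=
    { a := τ.a ≫ q'.intHom.1.1, b := 𝟙 q.tgt.1
      w := hw.trans ((Category.assoc _ _ _).symm.trans
        (congrArg (_ ≫ ·) (Category.comp_id _).symm)) }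
  let A : IntHom S₀ q.src q'.src := ⟨⟨τ.a, S₀.map pa q.intHom.1.2⟩,
    (map_map_eq_map (τ := sArrow q.intHom.1.1) (Category.comp_id _) hw.symm _).trans q.intHom.2.1,
    (map_map_eq_map (τ := τ ≫ sArrow q'.intHom.1.1)
      ((Category.id_comp _).trans (Category.comp_id _).symm) (Category.id_comp _) _).trans
      ((S₀.map_comp_apply _ _ _).trans ((congrArg _ hτ).trans q'.intHom.2.1))⟩
  let B : IntHom S₀ q'.tgt q.tgt := ⟨⟨τ.b, S₀.map pb q.intHom.1.2⟩,
    (map_map_eq_map (τ := τ ≫ tArrow q'.intHom.1.1) (Category.comp_id _)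
      ((Category.comp_id _).trans (Category.id_comp _).symm) _).trans
      ((S₀.map_comp_apply _ _ _).trans ((congrArg _ hτ).trans q'.intHom.2.2)),
    (map_map_eq_map (τ := tArrow q.intHom.1.1) ((Category.assoc _ _ _).trans hw.symm)
      (Category.comp_id _) _).trans q.intHom.2.2⟩
  let θr : twMk q.intHom.1.1 ⟶ twMk (q'.intHom.1.1 ≫ B.1.1) :=
    { a := τ.a, b := 𝟙 q.tgt.1
      w := hw.trans (congrArg (_ ≫ ·) (Category.comp_id _).symm) }
  refine ⟨({ a := A, b := B, w := ?_ } : TwHom q q'), rfl⟩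
  exact eq_intComp hadm.out (f := A) (g := intComp hadm.out q'.intHom B) (h := q.intHom)
    pa rfl rfl rfl θr rfl rfl (eq_intComp_snd hadm.out
      ((map_map_eq_map (Category.comp_id _) (Category.comp_id _) _).trans hτ)
      (map_map_eq_map rfl (Category.comp_id _) _))

variable (S₀) in
/-- The comparison functor `tw (∫̃_I S₀) ⥤ ∫_{tw I} S₀`. -/
def twToElements : TwObj (IntObj S₀) ⥤ S₀.Elements where
  obj q := ⟨twMk q.intHom.1.1, q.intHom.1.2⟩
  map θ := ⟨TwHom.toBase θ, TwHom.map_toBase θ⟩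
  map_id _ := rfl
  map_comp _ _ := rfl

instance : (twToElements S₀).Faithful where
  map_injective h := TwHom.toBase_injective (congrArg Subtype.val h)

instance : (twToElements S₀).Full where
  map_surjective τ := by
    obtain ⟨θ, hθ⟩ := TwHom.toBase_surjective τ.1 τ.2
    exact ⟨θ, Subtype.ext hθ⟩

theorem twToElements_obj_bijective : Function.Bijective (twToElements S₀).obj := by
  refine Function.bijective_iff_has_inverse.mpr
    ⟨fun p => ⟨(⟨⟨p.1.hom, p.2⟩, rfl, rfl⟩ :
      IntHom S₀ ⟨p.1.src, S₀.map (sArrow p.1.hom) p.2⟩ ⟨p.1.tgt, S₀.map (tArrow p.1.hom) p.2⟩)⟩,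
      ?_, fun _ => rfl⟩
  rintro @⟨⟨i, x⟩, ⟨j, y⟩, ⟨⟨φ, e⟩, hs, ht⟩⟩
  change i ⟶ j at φ
  change S₀.obj (twMk φ) at e
  obtain rfl : S₀.map (sArrow (i := i) (j := j) φ) e = x := hs
  obtain rfl : S₀.map (tArrow (i := i) (j := j) φ) e = y := ht
  rfl

end

/-- Let `S₀ : tw I → Set` be admissible.  Then (a) the prescribed
objects, morphisms, identities and compositions form a well-defined category `∫̃_I S₀`
(a category structure equal to `intStruct hadm` satisfying the category laws), and
(b) there is an isomorphism of categories `tw (∫̃_I S₀) ≅ ∫_{tw I} S₀` sending the object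
given by a morphism `(i,x) → (i',x')` with datum `(φ, y)` to the element `(φ, y)`. -/
theorem statement13 (S₀ : TwObj I ⥤ Type w) (hadm : Admissible S₀) :
    ∃ (inst : Category.{max v w} (IntObj S₀))
      (hstruct : inst.toCategoryStruct = intStruct hadm),
      PartB (inst := inst) S₀ hadm hstruct := by
  have : Fact (Admissible S₀) := ⟨hadm⟩
  obtain ⟨Ψ, h₁, h₂⟩ := exists_strict_inverse (twToElements S₀) twToElements_obj_bijective
  exact ⟨intCategory, rfl, twToElements S₀, Ψ, h₁, h₂, fun _ _ _ => rfl⟩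

end Paper
end

section
/- Let S be a small subcanonical geometric site with finite limits. Let F = L(⨿_j h(X_j)) be the sheafification of a coproduct of representable presheaves, and let Y and Z be coproducts of representable presheaves equipped with morphisms of presheaves Y → ιF and Z → ιF. Then the fiber product Y ×_{ιF} Z, computed in the category of presheaves, is again a coproduct of representable presheaves; in particular, for Y = h(Y₀) and Z = h(Z₀) representable, the presheaf h(Y₀) ×_{ιF} h(Z₀) is representable. -/
open CategoryTheory CategoryTheory.Limits

universe u

namespace CategoryTheory

/-- Coproducts of types are universal. -/
lemma isUniversalColimit_discrete_type {ι : Type*} {F : Discrete ι ⥤ Type u} {c : Cocone F}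
    (hc : IsColimit c) : IsUniversalColimit c := by
  obtain ⟨X, rfl⟩ : ∃ X, F = Discrete.functor X :=
    ⟨fun i ↦ F.obj ⟨i⟩, Functor.hext (fun _ ↦ rfl) (by rintro ⟨i⟩ ⟨j⟩ ⟨⟨rfl : i = j⟩⟩; simp)⟩
  intro F' c' α f w _ hp
  obtain ⟨P, rfl⟩ : ∃ P, F' = Discrete.functor P :=
    ⟨fun i ↦ F'.obj ⟨i⟩, Functor.hext (fun _ ↦ rfl) (by rintro ⟨i⟩ ⟨j⟩ ⟨⟨rfl : i = j⟩⟩; simp)⟩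
  change Cofan P at c'
  change Cofan X at c
  have hw (i : ι) (x : P i) : f (c'.inj i x) = c.inj i (α.app ⟨i⟩ x) :=
    (ConcreteCategory.congr_hom (hp ⟨i⟩).w x)
  rw [Cofan.nonempty_isColimit_iff_bijective_fromSigma]
  refine ⟨?_, fun z ↦ ?_⟩
  · rintro ⟨i, x⟩ ⟨j, y⟩ (hxy : c'.inj i x = c'.inj j y)
    have h := congrArg f hxy
    rw [hw, hw] at h
    obtain rfl := Cofan.eq_of_inj_apply_eq_of_isColimit hc _ _ h
    have h' := Cofan.inj_injective_of_isColimit hc _ h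
    rw [Types.ext_of_isPullback (hp ⟨i⟩) hxy h']
  · obtain ⟨i, y, hy⟩ := Cofan.inj_jointly_surjective_of_isColimit hc (f z)
    obtain ⟨x, hx, -⟩ := Types.exists_of_isPullback (hp ⟨i⟩) z y hy.symm
    exact ⟨⟨i, x⟩, hx⟩

/-- Coproducts of presheaves of types are universal. -/
lemma isUniversalColimit_discrete_presheaf {C : Type*} [Category* C] {ι : Type u}
    {F : Discrete ι ⥤ C ⥤ Type u} {c : Cocone F} (hc : IsColimit c) :
    IsUniversalColimit c := by
  intro F' c' α f w _ hp
  refine ⟨evaluationJointlyReflectsColimits _ fun U ↦ Nonempty.some ?_⟩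
  exact isUniversalColimit_discrete_type
    (isColimitOfPreserves ((evaluation C (Type u)).obj U) hc) _
    (Functor.whiskerRight α ((evaluation C (Type u)).obj U)) (f.app U)
    (by ext j x; exact ConcreteCategory.congr_hom (congr_app (congr_app w j) U) x)
    (NatTrans.Equifibered.of_discrete _)
    (fun j ↦ (hp j).map ((evaluation C (Type u)).obj U))

/-- If the pullbacks of all pairs of components are representable, then so is, up to
coproducts, the pullback of two coproducts of representable presheaves. -/
lemma exists_pullback_iso_sigma_yoneda {S : Type u} [SmallCategory S] {G : Sᵒᵖ ⥤ Type u}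
    (hG : ∀ (Y Z : S) (φ : yoneda.obj Y ⟶ G) (ψ : yoneda.obj Z ⟶ G),
      ∃ W : S, Nonempty (pullback φ ψ ≅ yoneda.obj W))
    {A B : Type u} {Y : A → S} {Z : B → S}
    (φ : (∐ fun a ↦ yoneda.obj (Y a)) ⟶ G) (ψ : (∐ fun b ↦ yoneda.obj (Z b)) ⟶ G) :
    ∃ (W : Type u) (V : W → S), Nonempty (pullback φ ψ ≅ ∐ fun w ↦ yoneda.obj (V w)) := by
  let f (a : A) := Sigma.ι (fun a ↦ yoneda.obj (Y a)) a ≫ φ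
  let g (b : B) := Sigma.ι (fun b ↦ yoneda.obj (Z b)) b ≫ ψ
  choose V e using fun p : A × B ↦ hG _ _ (f p.1) (g p.2)
  refine ⟨A × B, V, ?_⟩
  have hP (a : A) (b : B) : IsPullback ((e (a, b)).some.inv ≫ pullback.fst (f a) (g b))
      ((e (a, b)).some.inv ≫ pullback.snd (f a) (g b)) (f a) (g b) :=
    (IsPullback.of_hasPullback (f a) (g b)).of_iso (e (a, b)).some (Iso.refl _) (Iso.refl _)
      (Iso.refl _) (by simp) (by simp) (by simp) (by simp)
  have h := (isUniversalColimit_discrete_presheaf (coproductIsCoproduct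
    fun a ↦ yoneda.obj (Y a))).isPullback_prod_of_isColimit
    (isUniversalColimit_discrete_presheaf (coproductIsCoproduct fun b ↦ yoneda.obj (Z b)))
    f g φ ψ (P := fun p ↦ yoneda.obj (V p)) hP _ (coproductIsCoproduct _)
    (fun _ ↦ rfl) (fun _ ↦ rfl)
  exact ⟨h.isoPullback.symm⟩

/-- For a subcanonical topology, if the pullbacks of the diagonal of a sheaf `F` along maps
from sheafified representables are representable, then so are the pullbacks, computed in
presheaves, of representable presheaves over `F`. -/
lemma exists_pullback_iso_yoneda {S : Type u} [SmallCategory S] [HasFiniteLimits S]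
    {K : GrothendieckTopology S} (hsub : ∀ X : S, Presieve.IsSheaf K (yoneda.obj X))
    {F : Sheaf K (Type u)}
    (hF : ∀ (Y : S) (φ : (presheafToSheaf K (Type u)).obj (yoneda.obj Y) ⟶ F ⨯ F),
      ∃ Z : S, Nonempty (pullback φ (diag F) ≅
        (presheafToSheaf K (Type u)).obj (yoneda.obj Z)))
    {Y Z : S} (φ : yoneda.obj Y ⟶ (sheafToPresheaf K (Type u)).obj F)
    (ψ : yoneda.obj Z ⟶ (sheafToPresheaf K (Type u)).obj F) :
    ∃ W : S, Nonempty (pullback φ ψ ≅ yoneda.obj W) := by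
  have hs (X : S) := (isSheaf_iff_isSheaf_of_type K _).2 (hsub X)
  let adj := sheafificationAdjunction K (Type u)
  let a := (adj.homEquiv _ _).symm (yoneda.map (prod.fst : Y ⨯ Z ⟶ Y) ≫ φ)
  let b := (adj.homEquiv _ _).symm (yoneda.map (prod.snd : Y ⨯ Z ⟶ Z) ≫ ψ)
  let η : yoneda.obj (Y ⨯ Z) ≅ (sheafToPresheaf K (Type u)).obj
      ((presheafToSheaf K (Type u)).obj (yoneda.obj (Y ⨯ Z))) := isoSheafify K (hs _)
  have ha : η.hom ≫ (sheafToPresheaf K (Type u)).map a =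
      yoneda.map (prod.fst : Y ⨯ Z ⟶ Y) ≫ φ :=
    (adj.homEquiv_unit ..).symm.trans ((adj.homEquiv _ _).apply_symm_apply _)
  have hb : η.hom ≫ (sheafToPresheaf K (Type u)).map b =
      yoneda.map (prod.snd : Y ⨯ Z ⟶ Z) ≫ ψ :=
    (adj.homEquiv_unit ..).symm.trans ((adj.homEquiv _ _).apply_symm_apply _)
  obtain ⟨W, ⟨i⟩⟩ := hF _ (prod.lift a b)
  let e := pullback.fst (prod.lift a b) (diag F)
  have h₁ : e ≫ a = pullback.snd (prod.lift a b) (diag F) := by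
    have h := pullback.condition (f := prod.lift a b) (g := diag F) =≫ prod.fst
    rwa [Category.assoc, Category.assoc, prod.lift_fst, prod.lift_fst, Category.comp_id] at h
  have h₂ : e ≫ b = pullback.snd (prod.lift a b) (diag F) := by
    have h := pullback.condition (f := prod.lift a b) (g := diag F) =≫ prod.snd
    rwa [Category.assoc, Category.assoc, prod.lift_snd, prod.lift_snd, Category.comp_id] at h
  have w : e ≫ a = e ≫ b := h₁.trans h₂.symm
  have he : IsLimit (Fork.ofι e w) := Fork.IsLimit.mk' _ fun s ↦
    ⟨pullback.lift s.ι (s.ι ≫ a) (by ext <;> simp [s.condition]), pullback.lift_fst _ _ _,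
      fun {m} hm ↦ by
        have hm' : m ≫ e = s.ι := hm
        apply pullback.hom_ext
        · rw [pullback.lift_fst]; exact hm'
        · rw [pullback.lift_snd, ← h₁, ← hm', Category.assoc]⟩
  have he' := isLimitForkMapOfIsLimit (sheafToPresheaf K (Type u)) w he
  have hprod := mapIsLimitOfPreservesOfIsLimit yoneda _ _ (prodIsProd Y Z)
  let ε := (sheafToPresheaf K (Type u)).map e
  have hε : ε ≫ η.inv ≫ yoneda.map (prod.fst : Y ⨯ Z ⟶ Y) ≫ φ =
      ε ≫ η.inv ≫ yoneda.map (prod.snd : Y ⨯ Z ⟶ Z) ≫ ψ := by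
    rw [← ha, ← hb, η.inv_hom_id_assoc, η.inv_hom_id_assoc, ← Functor.map_comp,
      ← Functor.map_comp, w]
  have hP : IsPullback (ε ≫ η.inv ≫ yoneda.map (prod.fst : Y ⨯ Z ⟶ Y))
      (ε ≫ η.inv ≫ yoneda.map (prod.snd : Y ⨯ Z ⟶ Z)) φ ψ := by
    refine ⟨⟨by simpa using hε⟩, ⟨PullbackCone.isLimitAux' _ fun s ↦ ?_⟩⟩
    obtain ⟨r, hr₁, hr₂⟩ := BinaryFan.IsLimit.lift' hprod s.fst s.snd
    replace hr₁ : r ≫ yoneda.map prod.fst = s.fst := hr₁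
    replace hr₂ : r ≫ yoneda.map prod.snd = s.snd := hr₂
    obtain ⟨l, hl⟩ := Fork.IsLimit.lift' he' (r ≫ η.hom) (by
      rw [Category.assoc, Category.assoc, ha, hb, reassoc_of% hr₁, reassoc_of% hr₂, s.condition])
    replace hl : l ≫ ε = r ≫ η.hom := hl
    refine ⟨l, ?_, ?_, fun {m} hm₁ hm₂ ↦ Fork.IsLimit.hom_ext he' ?_⟩
    · change l ≫ ε ≫ η.inv ≫ yoneda.map prod.fst = s.fst
      rw [reassoc_of% hl, η.hom_inv_id_assoc, hr₁]
    · change l ≫ ε ≫ η.inv ≫ yoneda.map prod.snd = s.snd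
      rw [reassoc_of% hl, η.hom_inv_id_assoc, hr₂]
    · change m ≫ ε = l ≫ ε
      rw [hl, ← Iso.comp_inv_eq]
      refine BinaryFan.IsLimit.hom_ext hprod ?_ ?_
      · exact (Category.assoc _ _ _).trans ((Category.assoc _ _ _).trans (hm₁.trans hr₁.symm))
      · exact (Category.assoc _ _ _).trans ((Category.assoc _ _ _).trans (hm₂.trans hr₂.symm))
  exact ⟨W, ⟨hP.isoPullback.symm ≪≫ (sheafToPresheaf K (Type u)).mapIso i ≪≫
    (isoSheafify K (hs W)).symm⟩⟩

end CategoryTheory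

/-- Let `S` be a small subcanonical geometric site with finite limits.
Let `F = L(⨿_j h(X_j))` be the sheafification of a coproduct of representables, and let
`Y`, `Z` be coproducts of representables with morphisms of presheaves `Y → ιF`, `Z → ιF`.
Then the fiber product `Y ×_{ιF} Z`, computed in presheaves, is again a coproduct of
representables; in particular for representable `Y`, `Z` it is representable. -/
theorem statement16 {S : Type u} [SmallCategory S] [HasFiniteLimits S]
    (K : Pretopology S)
    (hsub : ∀ X : S, Presieve.IsSheaf K.toGrothendieck (yoneda.obj X))
    (hgeom : ∀ (J : Type u) (Xf : J → S) (Y : S)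
      (φ : (presheafToSheaf K.toGrothendieck (Type u)).obj (yoneda.obj Y) ⟶
        (presheafToSheaf K.toGrothendieck (Type u)).obj (∐ fun j => yoneda.obj (Xf j)) ⨯
          (presheafToSheaf K.toGrothendieck (Type u)).obj (∐ fun j => yoneda.obj (Xf j))),
      ∃ Z : S, Nonempty
        (pullback φ
            (diag ((presheafToSheaf K.toGrothendieck (Type u)).obj
              (∐ fun j => yoneda.obj (Xf j)))) ≅
          (presheafToSheaf K.toGrothendieck (Type u)).obj (yoneda.obj Z)))
    (J : Type u) (Xf : J → S) :
    (∀ (A : Type u) (Ya : A → S) (B : Type u) (Zb : B → S)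
      (φ : (∐ fun a => yoneda.obj (Ya a)) ⟶
        (sheafToPresheaf K.toGrothendieck (Type u)).obj
          ((presheafToSheaf K.toGrothendieck (Type u)).obj (∐ fun j => yoneda.obj (Xf j))))
      (ψ : (∐ fun b => yoneda.obj (Zb b)) ⟶
        (sheafToPresheaf K.toGrothendieck (Type u)).obj
          ((presheafToSheaf K.toGrothendieck (Type u)).obj (∐ fun j => yoneda.obj (Xf j)))),
      ∃ (W : Type u) (Wf : W → S),
        Nonempty (pullback φ ψ ≅ ∐ fun w => yoneda.obj (Wf w))) ∧
    (∀ (Y₀ Z₀ : S)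
      (φ₀ : yoneda.obj Y₀ ⟶
        (sheafToPresheaf K.toGrothendieck (Type u)).obj
          ((presheafToSheaf K.toGrothendieck (Type u)).obj (∐ fun j => yoneda.obj (Xf j))))
      (ψ₀ : yoneda.obj Z₀ ⟶
        (sheafToPresheaf K.toGrothendieck (Type u)).obj
          ((presheafToSheaf K.toGrothendieck (Type u)).obj (∐ fun j => yoneda.obj (Xf j)))),
      ∃ W : S, Nonempty (pullback φ₀ ψ₀ ≅ yoneda.obj W)) := by
  have hF (Y Z : S) := exists_pullback_iso_yoneda hsub (hgeom J Xf) (Y := Y) (Z := Z)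
  exact ⟨fun _ _ _ _ φ ψ ↦ exists_pullback_iso_sigma_yoneda hF φ ψ, hF⟩
end
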